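/- Let a < b be real numbers and n ≥ 1 a natural number. Let μ₁, μ₂ be finite signed measures on ℝ concentrated on (a,b], with distribution functions F₁(x) = μ₁((a,x]), F₂(x) = μ₂((a,x]); define H₀ = F₂ − F₁ and H_k(x) = ∫_a^x H_{k−1}(t) dt for k = 1, …, n. Assume H_k(b) = 0 for all k = 0, 1, …, n. Suppose there are points a = x₀ < x₁ < ⋯ < x_m < x_{m+1} = b with m ODD such that the function H_{n−1} changes sign exactly at x₁, …, x_m with (−1)^{n+1} H_{n−1} ≥ 0 on (a, x₁), i.e., for each i = 0, 1, …, m, (−1)^{n+1+i} H_{n−1}(x) ≥ 0 for all x ∈ (x_i, x_{i+1}) and H_{n−1} is not identically zero on (x_i, x_{i+1}). Then ∫_{[a,b]} f dμ₁ ≤ ∫_{[a,b]} f dμ₂ for every continuous n-convex function f : [a,b] → ℝ if and only if (−1)^{n+1} H_n(x_{2j}) ≥ 0 for every j = 1, 2, …, (m−1)/2. -/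

import Mathlib

open MeasureTheory Set

/-- Integral of `f` with respect to a finite signed measure `μ`,
defined via the Jordan decomposition `μ = μ⁺ - μ⁻`. -/
noncomputable def sintegral (μ : SignedMeasure ℝ) (f : ℝ → ℝ) : ℝ :=
  (∫ x, f x ∂μ.toJordanDecomposition.posPart) - ∫ x, f x ∂μ.toJordanDecomposition.negPart

/-- Integral of `f` over a set `s` with respect to a finite signed measure `μ`. -/
noncomputable def sintegralOn (μ : SignedMeasure ℝ) (s : Set ℝ) (f : ℝ → ℝ) : ℝ :=
  (∫ x in s, f x ∂μ.toJordanDecomposition.posPart) - ∫ x in s, f x ∂μ.toJordanDecomposition.negPart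

/-- A signed measure `μ` is concentrated on `s` if `|μ|(sᶜ) = 0`. -/
def ConcentratedOn (μ : SignedMeasure ℝ) (s : Set ℝ) : Prop :=
  μ.totalVariation sᶜ = 0

/-- Iterated integrals based at `a`: `I₀ = F`, `I_{k+1}(x) = ∫_a^x I_k(t) dt`. -/
noncomputable def iterInt (a : ℝ) (F : ℝ → ℝ) : ℕ → ℝ → ℝ
  | 0 => F
  | k + 1 => fun x => ∫ t in a..x, iterInt a F k t

/-- `f` is `n`-convex on `(a,b)` (`n ≥ 1`): it is `(n-1)`-times differentiable on `(a,b)`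
and its `(n-1)`-st derivative is convex on `(a,b)`. -/
def NConvexOn (n : ℕ) (a b : ℝ) (f : ℝ → ℝ) : Prop :=
  ContDiffOn ℝ ((n - 1 : ℕ) : ℕ∞) f (Ioo a b) ∧
  ConvexOn ℝ (Ioo a b) (iteratedDerivWithin (n - 1) f (Ioo a b))

/-- Fubini on the triangle `a < x ≤ t ≤ b` for `k x * u t`. -/
lemma setIntegral_mul_integral_tail {a b : ℝ} (hab : a ≤ b) (ρ : Measure ℝ) [SFinite ρ]
    {k u : ℝ → ℝ} (hk : IntegrableOn k (Ioc a b) ρ) (hu : IntervalIntegrable u volume a b) :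
    ∫ x in Ioc a b, k x * (∫ t in x..b, u t) ∂ρ
      = ∫ t in a..b, u t * ∫ x in Ioc a t, k x ∂ρ := by
  rw [intervalIntegrable_iff_integrableOn_Ioc_of_le hab] at hu
  set Φ : ℝ → ℝ → ℝ := fun x t => {p : ℝ × ℝ | p.1 ≤ p.2}.indicator
    (fun p => k p.1 * u p.2) (x, t) with hΦ
  have hint : Integrable (Function.uncurry Φ)
      ((ρ.restrict (Ioc a b)).prod (volume.restrict (Ioc a b))) :=
    (Integrable.mul_prod hk hu).indicator (measurableSet_le measurable_fst measurable_snd)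
  rw [intervalIntegral.integral_of_le hab]
  calc _ = ∫ x in Ioc a b, (∫ t in Ioc a b, Φ x t) ∂ρ := by
        refine setIntegral_congr_fun measurableSet_Ioc fun x hx => ?_
        have : ∀ t, Φ x t = (Ici x).indicator (fun t => k x * u t) t := fun t => by
          simp [hΦ, indicator]
        simp only [this]
        rw [setIntegral_indicator measurableSet_Ici, integral_const_mul,
          intervalIntegral.integral_of_le hx.2, ← integral_Icc_eq_integral_Ioc]
        congr 3
        ext t
        simp only [mem_Icc, mem_inter_iff, mem_Ioc, mem_Ici]
        exact ⟨fun h => ⟨⟨hx.1.trans_le h.1, h.2⟩, h.1⟩, fun h => ⟨h.2, h.1.2⟩⟩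
    _ = ∫ t in Ioc a b, (∫ x in Ioc a b, Φ x t ∂ρ) := integral_integral_swap hint
    _ = _ := by
        refine setIntegral_congr_fun measurableSet_Ioc fun t ht => ?_
        have : ∀ x, Φ x t = (Iic t).indicator (fun x => u t * k x) x := fun x => by
          simp [hΦ, indicator, mul_comm]
        simp only [this]
        rw [setIntegral_indicator measurableSet_Iic, integral_const_mul]
        congr 3
        ext x
        simp only [mem_inter_iff, mem_Ioc, mem_Iic]
        exact ⟨fun h => ⟨h.1.1, h.2⟩, fun h => ⟨⟨h.1, h.2.trans ht.2⟩, h.2⟩⟩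

/-- Integration by parts against a measure, `U` being a primitive of `u`. -/
lemma setIntegral_mul_eq_sub {a b : ℝ} (hab : a ≤ b) (ρ : Measure ℝ) [SFinite ρ]
    {k u U : ℝ → ℝ} (hk : IntegrableOn k (Ioc a b) ρ) (hu : IntervalIntegrable u volume a b)
    (hU : ∀ x ∈ Icc a b, U x = U b - ∫ t in x..b, u t) :
    ∫ x in Ioc a b, k x * U x ∂ρ
      = U b * (∫ x in Ioc a b, k x ∂ρ) - ∫ t in a..b, u t * ∫ x in Ioc a t, k x ∂ρ := by
  have hc : ContinuousOn (fun x => ∫ t in x..b, u t) (Icc a b) := by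
    have := intervalIntegral.continuousOn_primitive_interval_left
      (μ := volume) (f := u) (a := a) (b := b)
      (by rw [uIcc_of_le hab, integrableOn_Icc_iff_integrableOn_Ioc]
          exact (intervalIntegrable_iff_integrableOn_Ioc_of_le hab).1 hu)
    rwa [uIcc_of_le hab] at this
  have hint : IntegrableOn (fun x => k x * ∫ t in x..b, u t) (Ioc a b) ρ := by
    obtain ⟨C, hC⟩ := isCompact_Icc.exists_bound_of_continuousOn hc
    refine Integrable.mul_bdd (c := C) hk
      ((hc.mono Ioc_subset_Icc_self).aestronglyMeasurable measurableSet_Ioc) ?_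
    filter_upwards [ae_restrict_mem measurableSet_Ioc] with x hx
    exact hC x (Ioc_subset_Icc_self hx)
  rw [← setIntegral_mul_integral_tail hab ρ hk hu, ← integral_const_mul,
    ← integral_sub (hk.const_mul _) hint]
  refine setIntegral_congr_fun measurableSet_Ioc fun x hx => ?_
  rw [hU x (Ioc_subset_Icc_self hx)]
  ring

/-- `u 0, …, u n` is a chain of successive right derivatives on `[a,b]`, continuous up to
order `n - 1` and with monotone last term. -/
structure RightDerivChain (a b : ℝ) (n : ℕ) (u : ℕ → ℝ → ℝ) : Prop where
  cont : ∀ k < n, ContinuousOn (u k) (Icc a b)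
  deriv : ∀ k < n, ∀ x ∈ Ioo a b, HasDerivWithinAt (u k) (u (k + 1) x) (Ioi x) x
  mono : MonotoneOn (u n) (Icc a b)

lemma RightDerivChain.intervalIntegrable {a b : ℝ} (hab : a ≤ b) {n : ℕ} {u : ℕ → ℝ → ℝ}
    (h : RightDerivChain a b n u) {k : ℕ} (hk : k ≤ n) : IntervalIntegrable (u k) volume a b := by
  rcases hk.lt_or_eq with hk | rfl
  · exact (by rw [uIcc_of_le hab]; exact h.cont k hk : ContinuousOn _ (uIcc a b)).intervalIntegrable
  · exact (by rw [uIcc_of_le hab]; exact h.mono : MonotoneOn _ (uIcc a b)).intervalIntegrable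

lemma RightDerivChain.eq_sub_integral {a b : ℝ} (hab : a ≤ b) {n : ℕ} {u : ℕ → ℝ → ℝ}
    (h : RightDerivChain a b n u) {k : ℕ} (hk : k < n) {x : ℝ} (hx : x ∈ Icc a b) :
    u k x = u k b - ∫ t in x..b, u (k + 1) t := by
  rw [intervalIntegral.integral_eq_sub_of_hasDeriv_right_of_le hx.2
    ((h.cont k hk).mono (Icc_subset_Icc_left hx.1))
    (fun y hy => h.deriv k hk y ⟨hx.1.trans_lt hy.1, hy.2⟩)
    ((h.intervalIntegrable hab hk).mono_set
      (by rw [uIcc_of_le hab, uIcc_of_le hx.2]; exact Icc_subset_Icc_left hx.1))]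
  ring

lemma intervalIntegrable_iterInt {a b : ℝ} {F : ℝ → ℝ} (hF : IntervalIntegrable F volume a b)
    (k : ℕ) : IntervalIntegrable (iterInt a F k) volume a b := by
  induction k with
  | zero => exact hF
  | succ k ih =>
    exact (intervalIntegral.continuousOn_primitive_interval' ih left_mem_uIcc).intervalIntegrable

lemma RightDerivChain.integral_mul_iterInt {a b : ℝ} (hab : a ≤ b) {n : ℕ} {u : ℕ → ℝ → ℝ}
    (h : RightDerivChain a b n u) {F : ℝ → ℝ} (hF : IntervalIntegrable F volume a b)
    (hb : ∀ k ≤ n, iterInt a F k b = 0) {k : ℕ} (hk : k + 1 ≤ n) :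
    ∫ t in a..b, u 1 t * F t = (-1) ^ k * ∫ t in a..b, u (k + 1) t * iterInt a F k t := by
  induction k with
  | zero => simp [iterInt]
  | succ k ih =>
    rw [ih (by omega), pow_succ, mul_assoc]
    congr 1
    have hI := intervalIntegrable_iterInt hF k
    have := setIntegral_mul_eq_sub hab volume
      ((intervalIntegrable_iff_integrableOn_Ioc_of_le hab).1 hI)
      (h.intervalIntegrable hab hk) (fun x hx => h.eq_sub_integral hab (k := k + 1) (by omega) hx)
    have hb' : ∫ x in Ioc a b, iterInt a F k x = 0 := by
      rw [← intervalIntegral.integral_of_le hab]; exact hb (k + 1) (by omega)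
    rw [hb', mul_zero, zero_sub, ← intervalIntegral.integral_of_le hab] at this
    simp only [mul_comm (u (k + 1) _)]
    rw [this, neg_one_mul]
    congr 1
    refine intervalIntegral.integral_congr fun t ht => ?_
    rw [uIcc_of_le hab] at ht
    simp only [iterInt]
    rw [intervalIntegral.integral_of_le ht.1]

lemma signedMeasure_apply_eq_jordan (μ : SignedMeasure ℝ) {s : Set ℝ} (hs : MeasurableSet s) :
    μ s = μ.toJordanDecomposition.posPart.real s - μ.toJordanDecomposition.negPart.real s := by
  conv_lhs => rw [← μ.toSignedMeasure_toJordanDecomposition]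
  rw [JordanDecomposition.toSignedMeasure, Measure.toSignedMeasure_sub_apply hs]

lemma intervalIntegrable_real_Ioc (ρ : Measure ℝ) [IsFiniteMeasure ρ] (a b : ℝ) :
    IntervalIntegrable (fun t => ρ.real (Ioc a t)) volume a b :=
  Monotone.intervalIntegrable fun _ _ hst => measureReal_mono (Ioc_subset_Ioc_right hst)

lemma intervalIntegrable_signedMeasure_Ioc (μ : SignedMeasure ℝ) (a b : ℝ) :
    IntervalIntegrable (fun t => μ (Ioc a t)) volume a b := by
  simp only [fun t => signedMeasure_apply_eq_jordan μ (measurableSet_Ioc (a := a) (b := t))]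
  exact (intervalIntegrable_real_Ioc _ a b).sub (intervalIntegrable_real_Ioc _ a b)

lemma integrable_monotone_mul {a b : ℝ} {u H : ℝ → ℝ} (hab : a ≤ b)
    (hu : IntervalIntegrable u volume a b) (hH : Monotone H) :
    IntervalIntegrable (fun t => u t * H t) volume a b := by
  rw [intervalIntegrable_iff_integrableOn_Ioc_of_le hab] at hu ⊢
  refine Integrable.mul_bdd (c := max |H a| |H b|) hu hH.measurable.aestronglyMeasurable ?_
  filter_upwards [ae_restrict_mem measurableSet_Ioc] with x hx
  exact abs_le_max_abs_abs (hH hx.1.le) (hH hx.2)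

lemma sintegralOn_Icc_eq {a b : ℝ} (hab : a ≤ b) {μ : SignedMeasure ℝ}
    (hμ : ConcentratedOn μ (Ioc a b)) {u U : ℝ → ℝ} (hu : IntervalIntegrable u volume a b)
    (hU : ∀ x ∈ Icc a b, U x = U b - ∫ t in x..b, u t) :
    sintegralOn μ (Icc a b) U = U b * μ (Ioc a b) - ∫ t in a..b, u t * μ (Ioc a t) := by
  have hz : μ.toJordanDecomposition.posPart (Ioc a b)ᶜ = 0 ∧
      μ.toJordanDecomposition.negPart (Ioc a b)ᶜ = 0 := by
    simpa [ConcentratedOn, SignedMeasure.totalVariation] using hμ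
  have key : ∀ ρ : Measure ℝ, IsFiniteMeasure ρ → ρ (Ioc a b)ᶜ = 0 →
      ∫ x in Icc a b, U x ∂ρ = U b * ρ.real (Ioc a b) - ∫ t in a..b, u t * ρ.real (Ioc a t) := by
    intro ρ _ hρ
    have h1 : Icc a b =ᵐ[ρ] Ioc a b := by
      have : ∀ᵐ x ∂ρ, x ∈ Ioc a b := hρ
      filter_upwards [this] with x hx
      exact propext ⟨fun _ => hx, fun _ => Ioc_subset_Icc_self hx⟩
    rw [setIntegral_congr_set h1]
    simpa using setIntegral_mul_eq_sub hab ρ (k := fun _ => 1) integrableOn_const hu hU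
  have hm : ∀ ρ : Measure ℝ, IsFiniteMeasure ρ → Monotone fun t => ρ.real (Ioc a t) :=
    fun ρ _ _ _ hst => measureReal_mono (Ioc_subset_Ioc_right hst)
  simp only [fun t => signedMeasure_apply_eq_jordan μ (measurableSet_Ioc (a := a) (b := t)), mul_sub]
  rw [intervalIntegral.integral_sub (integrable_monotone_mul hab hu (hm _ inferInstance))
    (integrable_monotone_mul hab hu (hm _ inferInstance)), sintegralOn,
    key _ inferInstance hz.1, key _ inferInstance hz.2]
  ring

lemma integral_mul_nonpos_of_primitive_nonneg {a b : ℝ} (hab : a ≤ b) {g K : ℝ → ℝ}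
    (hg : MonotoneOn g (Icc a b)) (hK : IntervalIntegrable K volume a b)
    (hG : ∀ t ∈ Icc a b, 0 ≤ ∫ s in a..t, K s) (hGb : ∫ s in a..b, K s = 0) :
    ∫ t in a..b, g t * K t ≤ 0 := by
  obtain ⟨g', hg', hgg'⟩ : ∃ g' : ℝ → ℝ, Monotone g' ∧ EqOn g g' (Icc a b) := by
    refine ⟨IccExtend hab (fun x : Icc a b => g x), ?_, fun x hx => ?_⟩
    · exact Monotone.IccExtend (h := hab) (f := fun x : Icc a b => g x) fun x y hxy => hg x.2 y.2 hxy
    · rw [IccExtend_of_mem hab _ hx]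
  set S := hg'.stieltjesFunction with hS
  have hSg : ∀ᵐ t, S t = g' t := by
    filter_upwards [hg'.countable_not_continuousAt.ae_notMem volume] with t ht
    rw [hS, hg'.stieltjesFunction_eq]
    exact (not_not.1 ht).continuousWithinAt.rightLim_eq
  have h1 : ∫ t in a..b, g t * K t = ∫ t in a..b, K t * (S t - S a) := by
    have : ∫ t in a..b, g t * K t = ∫ t in a..b, K t * S t := by
      refine intervalIntegral.integral_congr_ae ?_
      filter_upwards [hSg] with t ht hta
      rw [uIoc_of_le hab] at hta
      rw [ht, hgg' (Ioc_subset_Icc_self hta), mul_comm]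
    simp only [mul_sub]
    rw [intervalIntegral.integral_sub, intervalIntegral.integral_mul_const, hGb, zero_mul, sub_zero,
      this]
    · exact integrable_monotone_mul hab hK S.mono
    · exact hK.mul_const _
  have h2 := setIntegral_mul_integral_tail hab S.measure (k := fun _ => 1)
    (integrableOn_const (by simp)) hK
  have h3 : ∫ t in a..b, K t * (S t - S a) = ∫ t in a..b, K t * ∫ x in Ioc a t, 1 ∂S.measure := by
    refine intervalIntegral.integral_congr fun t ht => ?_
    rw [uIcc_of_le hab] at ht
    simp [measureReal_def, ENNReal.toReal_ofReal (sub_nonneg.2 (S.mono ht.1))]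
  rw [h1, h3, ← h2]
  refine setIntegral_nonpos measurableSet_Ioc fun x hx => ?_
  have hx' := Ioc_subset_Icc_self hx
  have := intervalIntegral.integral_add_adjacent_intervals
    (hK.mono_set (c := a) (d := x) (by
      rw [uIcc_of_le hab, uIcc_of_le hx'.1]; exact Icc_subset_Icc_right hx'.2))
    (hK.mono_set (c := x) (d := b) (by
      rw [uIcc_of_le hab, uIcc_of_le hx'.2]; exact Icc_subset_Icc_left hx'.1))
  have := hG x hx'
  linarith

lemma RightDerivChain.sintegralOn_sub_sintegralOn {a b : ℝ} (hab : a ≤ b)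
    {μ₁ μ₂ : SignedMeasure ℝ} (hμ₁ : ConcentratedOn μ₁ (Ioc a b))
    (hμ₂ : ConcentratedOn μ₂ (Ioc a b)) {p : ℕ} {u : ℕ → ℝ → ℝ}
    (h : RightDerivChain a b (p + 1) u)
    (hb : ∀ k ≤ p + 1, iterInt a (fun t => μ₂ (Ioc a t) - μ₁ (Ioc a t)) k b = 0) :
    sintegralOn μ₂ (Icc a b) (u 0) - sintegralOn μ₁ (Icc a b) (u 0)
      = (-1) ^ (p + 1) * ∫ t in a..b,
          u (p + 1) t * iterInt a (fun t => μ₂ (Ioc a t) - μ₁ (Ioc a t)) p t := by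
  have hu := h.intervalIntegrable hab (k := 1) (by omega)
  have hU : ∀ x ∈ Icc a b, u 0 x = u 0 b - ∫ t in x..b, u 1 t :=
    fun x hx => h.eq_sub_integral hab (by omega) hx
  have hi : ∀ μ : SignedMeasure ℝ,
      IntervalIntegrable (fun t => u 1 t * μ (Ioc a t)) volume a b := by
    intro μ
    simp only [fun t => signedMeasure_apply_eq_jordan μ (measurableSet_Ioc (a := a) (b := t)),
      mul_sub]
    exact (integrable_monotone_mul hab hu fun _ _ hst =>
      measureReal_mono (Ioc_subset_Ioc_right hst)).sub (integrable_monotone_mul hab hu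
        fun _ _ hst => measureReal_mono (Ioc_subset_Ioc_right hst))
  rw [pow_succ, mul_comm _ (-1 : ℝ), mul_assoc, ← h.integral_mul_iterInt hab
    ((intervalIntegrable_signedMeasure_Ioc μ₂ a b).sub (intervalIntegrable_signedMeasure_Ioc μ₁ a b))
    hb le_rfl, sintegralOn_Icc_eq hab hμ₁ hu hU, sintegralOn_Icc_eq hab hμ₂ hu hU]
  simp only [mul_sub]
  rw [intervalIntegral.integral_sub (hi μ₂) (hi μ₁)]
  have h0 : μ₂ (Ioc a b) - μ₁ (Ioc a b) = 0 := hb 0 (by omega)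
  linear_combination u 0 b * h0

/-- The contraction of ratio `r` towards the midpoint of `[a,b]`. -/
noncomputable def contraction (a b r x : ℝ) : ℝ := (a + b) / 2 + r * (x - (a + b) / 2)

lemma contraction_mem_Ioo {a b r x : ℝ} (hab : a < b) (hr : r ∈ Ioo (0 : ℝ) 1)
    (hx : x ∈ Icc a b) : contraction a b r x ∈ Ioo a b := by
  obtain ⟨hr0, hr1⟩ := hr
  obtain ⟨hx1, hx2⟩ := hx
  constructor <;> unfold contraction <;> nlinarith

lemma tendsto_sintegralOn_comp_contraction {a b : ℝ} (hab : a < b) (μ : SignedMeasure ℝ)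
    {f : ℝ → ℝ} (hf : ContinuousOn f (Icc a b)) :
    Filter.Tendsto (fun r => sintegralOn μ (Icc a b) fun x => f (contraction a b r x))
      (nhdsWithin 1 (Iio 1)) (nhds (sintegralOn μ (Icc a b) f)) := by
  have hev : ∀ᶠ r : ℝ in nhdsWithin 1 (Iio 1), r ∈ Ioo (0 : ℝ) 1 :=
    Ioo_mem_nhdsLT zero_lt_one
  obtain ⟨C, hC⟩ := isCompact_Icc.exists_bound_of_continuousOn hf
  have key : ∀ ρ : Measure ℝ, IsFiniteMeasure ρ →
      Filter.Tendsto (fun r => ∫ x in Icc a b, f (contraction a b r x) ∂ρ)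
        (nhdsWithin 1 (Iio 1)) (nhds (∫ x in Icc a b, f x ∂ρ)) := by
    intro ρ _
    refine tendsto_integral_filter_of_dominated_convergence (fun _ => C) ?_ ?_
      (integrable_const C) ?_
    · filter_upwards [hev] with r hr
      refine ContinuousOn.aestronglyMeasurable (hf.comp (Continuous.continuousOn ?_)
        fun x hx => Ioo_subset_Icc_self (contraction_mem_Ioo hab hr hx)) measurableSet_Icc
      unfold contraction
      fun_prop
    · filter_upwards [hev] with r hr
      filter_upwards [ae_restrict_mem measurableSet_Icc] with x hx
      exact hC _ (Ioo_subset_Icc_self (contraction_mem_Ioo hab hr hx))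
    · filter_upwards [ae_restrict_mem measurableSet_Icc] with x hx
      refine (hf x hx).tendsto.comp (tendsto_nhdsWithin_iff.2 ⟨?_, ?_⟩)
      · have : Continuous fun r => contraction a b r x := by
          unfold contraction
          fun_prop
        have h1 := this.tendsto 1
        simp only [contraction, one_mul, add_sub_cancel] at h1
        exact h1.mono_left nhdsWithin_le_nhds
      · filter_upwards [hev] with r hr
        exact Ioo_subset_Icc_self (contraction_mem_Ioo hab hr hx)
  exact (key _ inferInstance).sub (key _ inferInstance)

/-- A contraction of an `n`-convex function starts a chain of right derivatives up to the
endpoints. -/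
lemma NConvexOn.exists_rightDerivChain {a b r : ℝ} (hab : a < b) (hr : r ∈ Ioo (0 : ℝ) 1) {p : ℕ}
    {f : ℝ → ℝ} (hf : NConvexOn (p + 1) a b f) :
    ∃ u, RightDerivChain a b (p + 1) u ∧ u 0 = fun x => f (contraction a b r x) := by
  obtain ⟨hd, hc⟩ := hf
  simp only [Nat.add_sub_cancel] at hd hc
  set D : ℕ → ℝ → ℝ := fun k => iteratedDerivWithin k f (Ioo a b) with hD
  set E : ℕ → ℝ → ℝ := fun k y => if k ≤ p then D k y else derivWithin (D p) (Ioi y) y with hE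
  have hElow : ∀ k ≤ p, E k = D k := fun k hk => by ext y; simp [hE, hk]
  have hEtop : E (p + 1) = fun y => derivWithin (D p) (Ioi y) y := by ext y; simp [hE]
  have hEcont : ∀ k ≤ p, ContinuousOn (E k) (Ioo a b) := fun k hk => by
    rw [hElow k hk]
    exact hd.continuousOn_iteratedDerivWithin (by exact_mod_cast hk) isOpen_Ioo.uniqueDiffOn
  have hEderiv : ∀ k ≤ p, ∀ y ∈ Ioo a b, HasDerivWithinAt (E k) (E (k + 1) y) (Ioi y) y := by
    intro k hk y hy
    rw [hElow k hk]
    rcases hk.lt_or_eq with hk' | rfl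
    · rw [hElow (k + 1) hk']
      have h1 := (hd.differentiableOn_iteratedDerivWithin (m := k) (by exact_mod_cast hk')
        isOpen_Ioo.uniqueDiffOn) y hy
      have h2 := h1.hasDerivWithinAt
      rw [← iteratedDerivWithin_succ] at h2
      exact (h2.hasDerivAt (isOpen_Ioo.mem_nhds hy)).hasDerivWithinAt
    · rw [hEtop]
      exact hc.hasDerivWithinAt_rightDeriv_of_mem_interior (by rwa [interior_Ioo])
  have hEmono : MonotoneOn (E (p + 1)) (Ioo a b) := by
    rw [hEtop, ← interior_Ioo]
    exact hc.monotoneOn_rightDeriv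
  have hmem : ∀ x ∈ Icc a b, contraction a b r x ∈ Ioo a b :=
    fun x hx => contraction_mem_Ioo hab hr hx
  have hcc : Continuous (contraction a b r) := by unfold contraction; fun_prop
  have hsm : StrictMono (contraction a b r) := fun x y hxy => by
    unfold contraction
    have := mul_lt_mul_of_pos_left hxy hr.1
    linarith
  refine ⟨fun k x => r ^ k * E k (contraction a b r x), ⟨fun k hk => ?_, fun k hk x hx => ?_, ?_⟩, ?_⟩
  · exact continuousOn_const.mul ((hEcont k (by omega)).comp hcc.continuousOn hmem)
  · have h1 : HasDerivWithinAt (contraction a b r) r (Ioi x) x := by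
      have := (((hasDerivAt_id x).sub_const ((a + b) / 2)).const_mul r).const_add ((a + b) / 2)
      rw [mul_one] at this
      exact this.hasDerivWithinAt
    have h2 := (hEderiv k (by omega) _ (hmem x (Ioo_subset_Icc_self hx))).comp x h1
      fun y hy => hsm hy
    refine (h2.const_mul (r ^ k)).congr_deriv ?_
    ring
  · exact fun x hx y hy hxy => mul_le_mul_of_nonneg_left
      (hEmono (hmem x hx) (hmem y hy) (hsm.monotone hxy)) (pow_nonneg hr.1.le _)
  · ext x
    simp [hE, hD]

lemma nConvexOn_of_hasDerivAt {a b : ℝ} {p : ℕ} {u : ℕ → ℝ → ℝ}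
    (hd : ∀ k < p, ∀ x ∈ Ioo a b, HasDerivAt (u k) (u (k + 1) x) x)
    (hc : ConvexOn ℝ (Ioo a b) (u p)) : NConvexOn (p + 1) a b (u 0) := by
  have key : ∀ k ≤ p, EqOn (iteratedDerivWithin k (u 0) (Ioo a b)) (u k) (Ioo a b) := by
    intro k hk
    induction k with
    | zero => exact fun x _ => by simp
    | succ k ih =>
      intro x hx
      rw [iteratedDerivWithin_succ, derivWithin_congr (ih (by omega)) (ih (by omega) hx)]
      exact (hd k hk x hx).hasDerivWithinAt.derivWithin (isOpen_Ioo.uniqueDiffOn x hx)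
  refine ⟨contDiffOn_of_continuousOn_differentiableOn_deriv ?_ ?_, ?_⟩
  · intro k hk
    have hk : k ≤ p := by exact_mod_cast hk
    refine ContinuousOn.congr ?_ (key k hk)
    rcases hk.lt_or_eq with hk | rfl
    · exact fun x hx => (hd k hk x hx).continuousAt.continuousWithinAt
    · exact hc.continuousOn isOpen_Ioo
  · intro k hk
    have hk : k < p := by exact_mod_cast hk
    exact DifferentiableOn.congr
      (fun x hx => (hd k hk x hx).differentiableAt.differentiableWithinAt) (key k hk.le)
  · exact hc.congr (key p le_rfl).symm

/-- The `k`-th (right) derivative of the truncated power `(x - t)₊ ^ n`. -/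
noncomputable def truncPow (t : ℝ) (n k : ℕ) (x : ℝ) : ℝ :=
  if t ≤ x then n.descFactorial k * (x - t) ^ (n - k) else 0

lemma hasDerivAt_truncPow_poly (t : ℝ) (n k : ℕ) (x : ℝ) :
    HasDerivAt (fun x => (n.descFactorial k : ℝ) * (x - t) ^ (n - k))
      (n.descFactorial (k + 1) * (x - t) ^ (n - (k + 1))) x := by
  refine ((((hasDerivAt_id x).sub_const t).pow (n - k)).const_mul
    (n.descFactorial k : ℝ)).congr_deriv ?_
  rw [Nat.descFactorial_succ, Nat.sub_sub]
  push_cast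
  simp
  ring

lemma hasDerivWithinAt_Ici_truncPow (t : ℝ) (n k : ℕ) (x : ℝ) :
    HasDerivWithinAt (truncPow t n k) (truncPow t n (k + 1) x) (Ici x) x := by
  rcases le_or_gt t x with h | h
  · have h1 := (hasDerivAt_truncPow_poly t n k x).hasDerivWithinAt (s := Ici x)
    rw [truncPow, if_pos h]
    exact h1.congr (fun y hy => if_pos (h.trans hy)) (if_pos h)
  · rw [truncPow, if_neg h.not_ge]
    refine HasDerivAt.hasDerivWithinAt ((hasDerivAt_const x (0 : ℝ)).congr_of_eventuallyEq ?_)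
    filter_upwards [Iio_mem_nhds h] with y hy
    exact if_neg (not_le.2 hy)

lemma hasDerivAt_truncPow (t : ℝ) {n k : ℕ} (hk : k + 1 < n) (x : ℝ) :
    HasDerivAt (truncPow t n k) (truncPow t n (k + 1) x) x := by
  refine HasDerivWithinAt.hasDerivAt (s := Ici x ∪ Iic x)
    ((hasDerivWithinAt_Ici_truncPow t n k x).union ?_) (by simp)
  rcases lt_or_ge t x with h | h
  · rw [truncPow, if_pos h.le]
    refine HasDerivAt.hasDerivWithinAt
      ((hasDerivAt_truncPow_poly t n k x).congr_of_eventuallyEq ?_)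
    filter_upwards [Ioi_mem_nhds h] with y hy
    exact if_pos (le_of_lt hy)
  · have hz : ∀ j < n, ∀ y ≤ t, truncPow t n j y = 0 := fun j hj y hy => by
      rcases hy.lt_or_eq with hy | rfl
      · exact if_neg hy.not_ge
      · simp [truncPow, (Nat.sub_pos_of_lt hj).ne']
    rw [hz _ hk x h]
    exact (hasDerivWithinAt_const x _ (0 : ℝ)).congr (fun y hy => hz k (by omega) y (hy.trans h))
      (hz k (by omega) x h)

lemma continuous_truncPow (t : ℝ) {n k : ℕ} (hk : k < n) : Continuous (truncPow t n k) := by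
  unfold truncPow
  refine Continuous.if_le (by fun_prop) (by fun_prop) (by fun_prop) (by fun_prop) ?_
  rintro x rfl
  simp [(Nat.sub_pos_of_lt hk).ne']

lemma rightDerivChain_truncPow (a b t : ℝ) (n : ℕ) : RightDerivChain a b n (truncPow t n) where
  cont k hk := (continuous_truncPow t hk).continuousOn
  deriv k _ x _ := (hasDerivWithinAt_Ici_truncPow t n k x).mono Ioi_subset_Ici_self
  mono := by
    intro x _ y _ hxy
    simp only [truncPow, Nat.sub_self, pow_zero, mul_one]
    split_ifs with h1 h2
    · exact le_rfl
    · exact absurd (h1.trans hxy) h2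
    · positivity
    · exact le_rfl

lemma nConvexOn_truncPow (a b t : ℝ) (p : ℕ) :
    NConvexOn (p + 1) a b (truncPow t (p + 1) 0) := by
  refine nConvexOn_of_hasDerivAt (fun k hk x _ => hasDerivAt_truncPow t (by omega) x) ?_
  have h1 : ConvexOn ℝ (Ioo a b) (((p + 1).descFactorial p : ℝ) • ((fun x => x - t) ⊔ 0)) :=
    (((convexOn_id (convex_Ioo a b)).sub (concaveOn_const t (convex_Ioo a b))).sup
      (convexOn_const 0 (convex_Ioo a b))).smul (by positivity)
  refine h1.congr fun x _ => ?_
  simp only [truncPow, Nat.add_sub_cancel_left, pow_one]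
  split_ifs with h
  · simp [h]
  · simp [(not_le.1 h).le]

lemma integral_truncPow_self_mul {a b t : ℝ} (ht : t ∈ Icc a b) (n : ℕ) {K : ℝ → ℝ}
    (hK : IntervalIntegrable K volume a b) (hKb : ∫ s in a..b, K s = 0) :
    ∫ s in a..b, truncPow t n n s * K s = -(n.factorial * ∫ s in a..t, K s) := by
  have hab := ht.1.trans ht.2
  have hK1 : IntervalIntegrable K volume a t := hK.mono_set (by
    rw [uIcc_of_le hab, uIcc_of_le ht.1]; exact Icc_subset_Icc_right ht.2)
  have hK2 : IntervalIntegrable K volume t b := hK.mono_set (by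
    rw [uIcc_of_le hab, uIcc_of_le ht.2]; exact Icc_subset_Icc_left ht.1)
  have h1 : ∫ s in a..b, truncPow t n n s * K s = ∫ s in Icc t b, n.factorial * K s := by
    rw [intervalIntegral.integral_of_le hab, ← integral_Icc_eq_integral_Ioc]
    have : ∀ s, truncPow t n n s * K s = (Ici t).indicator (fun s => n.factorial * K s) s := by
      intro s
      by_cases h : t ≤ s <;> simp [truncPow, h, Nat.descFactorial_self]
    simp only [this]
    rw [setIntegral_indicator measurableSet_Ici]
    congr 2
    ext s
    simp only [mem_inter_iff, mem_Icc, mem_Ici]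
    exact ⟨fun h => ⟨h.2, h.1.2⟩, fun h => ⟨⟨ht.1.trans h.1, h.2⟩, h.1⟩⟩
  have h2 := intervalIntegral.integral_add_adjacent_intervals hK1 hK2
  rw [h1, integral_Icc_eq_integral_Ioc, ← intervalIntegral.integral_of_le ht.2,
    intervalIntegral.integral_const_mul]
  linear_combination (n.factorial : ℝ) * h2 + (n.factorial : ℝ) * hKb

lemma exists_mem_Icc_of_partition {x : ℕ → ℝ} {t : ℝ} (m : ℕ) (h0 : x 0 ≤ t)
    (hm : t ≤ x (m + 1)) : ∃ i ≤ m, t ∈ Icc (x i) (x (i + 1)) := by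
  induction m with
  | zero => exact ⟨0, le_rfl, h0, hm⟩
  | succ m ih =>
    rcases le_total t (x (m + 1)) with h | h
    · obtain ⟨i, hi, hti⟩ := ih h
      exact ⟨i, by omega, hti⟩
    · exact ⟨m + 1, le_rfl, h, hm⟩

/-- If `K` is alternately nonnegative and nonpositive on the intervals of a partition, then its
primitive is nonnegative as soon as it is so at the points of even index. -/
lemma primitive_nonneg_of_alternating {a b : ℝ} {K : ℝ → ℝ} (hK : IntervalIntegrable K volume a b)
    {m : ℕ} {x : ℕ → ℝ} (hx : ∀ i ≤ m + 1, x i ∈ Icc a b)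
    (hx0 : x 0 = a) (hxlast : x (m + 1) = b)
    (hsign : ∀ i ≤ m, ∀ t ∈ Ioo (x i) (x (i + 1)), 0 ≤ (-1 : ℝ) ^ i * K t)
    (heven : ∀ i ≤ m + 1, Even i → 0 ≤ ∫ s in a..x i, K s) {t : ℝ}
    (ht : t ∈ Icc a b) : 0 ≤ ∫ s in a..t, K s := by
  obtain ⟨i, hi, hti⟩ := exists_mem_Icc_of_partition (x := x) (t := t) m (by rw [hx0]; exact ht.1)
    (by rw [hxlast]; exact ht.2)
  have hsub : ∀ y ∈ Icc a b, ∀ z ∈ Icc a b, IntervalIntegrable K volume y z := fun y hy z hz =>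
    hK.mono_set (by rw [uIcc_of_le (ht.1.trans ht.2)]; exact uIcc_subset_Icc hy hz)
  have ha : a ∈ Icc a b := ⟨le_rfl, ht.1.trans ht.2⟩
  have hi1 := hx i (by omega)
  have hi2 := hx (i + 1) (by omega)
  rcases Nat.even_or_odd i with he | ho
  · have h1 := intervalIntegral.integral_add_adjacent_intervals (hsub a ha _ hi1)
      (hsub _ hi1 t ht)
    have h2 : 0 ≤ ∫ s in x i..t, K s := by
      rw [intervalIntegral.integral_of_le hti.1, integral_Ioc_eq_integral_Ioo]
      refine setIntegral_nonneg measurableSet_Ioo fun s hs => ?_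
      simpa [he.neg_one_pow] using hsign i hi s ⟨hs.1, hs.2.trans_le hti.2⟩
    linarith [heven i (by omega) he]
  · have h1 := intervalIntegral.integral_add_adjacent_intervals (hsub a ha t ht)
      (hsub t ht _ hi2)
    have h2 : ∫ s in t..x (i + 1), K s ≤ 0 := by
      rw [intervalIntegral.integral_of_le hti.2, integral_Ioc_eq_integral_Ioo]
      refine setIntegral_nonpos measurableSet_Ioo fun s hs => ?_
      simpa [ho.neg_one_pow] using hsign i hi s ⟨hti.1.trans_lt hs.1, hs.2⟩
    linarith [heven (i + 1) (by omega) ho.add_one]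

/-- **Corollary 2.7b, odd case.** If `H_k(b) = 0` for `k = 0,…,n` and `H_{n−1}` changes
sign exactly at `x₁ < ⋯ < x_m` with `m` odd, starting with sign `(−1)^{n+1}` on `(a,x₁)`,
then `∫ f dμ₁ ≤ ∫ f dμ₂` holds for all continuous `n`-convex `f` iff
`(−1)^{n+1} H_n(x_{2j}) ≥ 0` for `j = 1,…,(m−1)/2`. -/
theorem statement11 (a b : ℝ) (hab : a < b) (n : ℕ) (hn : 1 ≤ n)
    (μ₁ μ₂ : SignedMeasure ℝ)
    (hμ₁ : ConcentratedOn μ₁ (Ioc a b)) (hμ₂ : ConcentratedOn μ₂ (Ioc a b))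
    (F₁ F₂ : ℝ → ℝ)
    (hF₁ : ∀ x, F₁ x = μ₁ (Ioc a x)) (hF₂ : ∀ x, F₂ x = μ₂ (Ioc a x))
    (hHb : ∀ k ≤ n, iterInt a (fun t => F₂ t - F₁ t) k b = 0)
    (m : ℕ) (hm : Odd m) (x : ℕ → ℝ)
    (hx0 : x 0 = a) (hxlast : x (m + 1) = b)
    (hmono : ∀ i ≤ m, x i < x (i + 1))
    (hsign : ∀ i ≤ m, ∀ t ∈ Ioo (x i) (x (i + 1)),
      0 ≤ (-1 : ℝ) ^ (n + 1 + i) * iterInt a (fun t => F₂ t - F₁ t) (n - 1) t)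
    (hnz : ∀ i ≤ m, ∃ t ∈ Ioo (x i) (x (i + 1)),
      iterInt a (fun t => F₂ t - F₁ t) (n - 1) t ≠ 0) :
    (∀ f : ℝ → ℝ, ContinuousOn f (Icc a b) → NConvexOn n a b f →
        sintegralOn μ₁ (Icc a b) f ≤ sintegralOn μ₂ (Icc a b) f) ↔
      (∀ j, 1 ≤ j → 2 * j < m →
        0 ≤ (-1 : ℝ) ^ (n + 1) * iterInt a (fun t => F₂ t - F₁ t) n (x (2 * j))) := by
  obtain ⟨p, rfl⟩ : ∃ p, n = p + 1 := ⟨n - 1, by omega⟩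
  obtain rfl : F₁ = fun t => μ₁ (Ioc a t) := funext hF₁
  obtain rfl : F₂ = fun t => μ₂ (Ioc a t) := funext hF₂
  simp only [Nat.add_sub_cancel] at *
  set F : ℝ → ℝ := fun t => μ₂ (Ioc a t) - μ₁ (Ioc a t) with hF
  have hFi : IntervalIntegrable F volume a b := (intervalIntegrable_signedMeasure_Ioc μ₂ a b).sub
    (intervalIntegrable_signedMeasure_Ioc μ₁ a b)
  have hHi := intervalIntegrable_iterInt hFi p
  have hHpb : ∫ s in a..b, iterInt a F p s = 0 := hHb (p + 1) le_rfl
  have hxmono : ∀ i j, i ≤ j → j ≤ m + 1 → x i ≤ x j := by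
    intro i j hij
    induction j, hij using Nat.le_induction with
    | base => exact fun _ => le_rfl
    | succ j _ ih => exact fun hj => (ih (by omega)).trans (hmono j (by omega)).le
  have hxmem : ∀ i ≤ m + 1, x i ∈ Icc a b := fun i hi =>
    ⟨hx0 ▸ hxmono 0 i (Nat.zero_le _) hi, hxlast ▸ hxmono i (m + 1) hi le_rfl⟩
  constructor
  · intro hf j hj hjm
    have ht := hxmem (2 * j) (by omega)
    have h1 := hf _ (continuous_truncPow (x (2 * j)) (n := p + 1) (k := 0) (by omega)).continuousOn
      (nConvexOn_truncPow a b (x (2 * j)) p)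
    have h2 := (rightDerivChain_truncPow a b (x (2 * j)) (p + 1)).sintegralOn_sub_sintegralOn
      hab.le hμ₁ hμ₂ hHb
    rw [integral_truncPow_self_mul ht _ hHi hHpb] at h2
    have h3 : 0 ≤ ((p + 1).factorial : ℝ) *
        ((-1) ^ (p + 1 + 1) * ∫ s in a..x (2 * j), iterInt a F p s) := by
      rw [pow_succ]
      linarith
    exact nonneg_of_mul_nonneg_right h3 (by positivity)
  · intro hj f hf hfn
    set K : ℝ → ℝ := fun s => (-1) ^ (p + 1 + 1) * iterInt a F p s with hKdef
    have hK : IntervalIntegrable K volume a b := hHi.const_mul _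
    have hG : ∀ t, ∫ s in a..t, K s = (-1) ^ (p + 1 + 1) * iterInt a F (p + 1) t :=
      fun t => intervalIntegral.integral_const_mul _ _
    have hGb : ∫ s in a..b, K s = 0 := by rw [hG, hHb _ le_rfl, mul_zero]
    have hpos : ∀ t ∈ Icc a b, 0 ≤ ∫ s in a..t, K s := by
      intro t ht
      refine primitive_nonneg_of_alternating hK hxmem hx0 hxlast (fun i hi s hs => ?_)
        (fun i hi he => ?_) ht
      · have := hsign i hi s hs
        rw [pow_add, mul_comm ((-1 : ℝ) ^ (p + 1 + 1)), mul_assoc] at this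
        exact this
      · obtain ⟨j, rfl⟩ := even_iff_two_dvd.1 he
        rcases Nat.eq_zero_or_pos j with rfl | hj0
        · simp [hx0]
        · rcases hi.lt_or_eq with hlt | heq
          · rw [hG]
            obtain ⟨q, rfl⟩ := hm
            exact hj j hj0 (by omega)
          · rw [heq, hxlast, hGb]
    have happrox : ∀ r ∈ Ioo (0 : ℝ) 1,
        sintegralOn μ₁ (Icc a b) (fun x => f (contraction a b r x)) ≤
          sintegralOn μ₂ (Icc a b) (fun x => f (contraction a b r x)) := by
      intro r hr
      obtain ⟨u, hu, hu0⟩ := hfn.exists_rightDerivChain hab hr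
      have h1 := hu.sintegralOn_sub_sintegralOn hab.le hμ₁ hμ₂ hHb
      have h2 := integral_mul_nonpos_of_primitive_nonneg hab.le hu.mono hK hpos hGb
      simp only [hKdef, mul_left_comm (u _ _)] at h2
      rw [intervalIntegral.integral_const_mul, pow_succ] at h2
      rw [← hu0]
      linarith
    refine le_of_tendsto_of_tendsto (tendsto_sintegralOn_comp_contraction hab μ₁ hf)
      (tendsto_sintegralOn_comp_contraction hab μ₂ hf) ?_
    filter_upwards [Ioo_mem_nhdsLT (zero_lt_one' ℝ)] with r hr
    exact happrox r hr
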